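/- There exists a constant c > 0 such that p̄(r,t) ≤ c φ^{-1}(1/r) for all r, t > 0. -/

import Mathlib

open MeasureTheory Filter Set
open scoped ENNReal Topology

open ProbabilityTheory in
/-- Finite measures on `ℝ` whose moment-generating functions are finite and agree on an open
interval around `0` are equal. -/
theorem MeasureTheory.Measure.ext_of_mgf_eqOn {A B : Measure ℝ}
    [IsFiniteMeasure A] [IsFiniteMeasure B]
    {U : Set ℝ} (hU : IsOpen U) (hUc : Convex ℝ U) (h0 : (0 : ℝ) ∈ U)
    (hA : U ⊆ integrableExpSet id A) (hB : U ⊆ integrableExpSet id B)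
    (h : EqOn (mgf id A) (mgf id B) U) : A = B := by
  have hA' : AnalyticOnNhd ℂ (complexMGF id A) {z | z.re ∈ U} := fun z hz =>
    analyticOnNhd_complexMGF z (interior_maximal hA hU hz)
  have hB' : AnalyticOnNhd ℂ (complexMGF id B) {z | z.re ∈ U} := fun z hz =>
    analyticOnNhd_complexMGF z (interior_maximal hB hU hz)
  have key : EqOn (complexMGF id A) (complexMGF id B) {z | z.re ∈ U} := by
    refine AnalyticOnNhd.eqOn_of_preconnected_of_frequently_eq hA' hB'
      (hUc.linear_preimage Complex.reLm).isPreconnected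
      (z₀ := ((0 : ℝ) : ℂ)) (by simpa using h0) ?_
    have h_tendsto : Tendsto (fun x : ℝ => (x : ℂ)) (𝓝[≠] (0 : ℝ)) (𝓝[≠] ((0 : ℝ) : ℂ)) := by
      refine tendsto_nhdsWithin_iff.2 ⟨(Complex.continuous_ofReal.tendsto 0).mono_left
        nhdsWithin_le_nhds, ?_⟩
      filter_upwards [self_mem_nhdsWithin] with x hx
      simpa using hx
    refine h_tendsto.frequently (Eventually.frequently ?_)
    filter_upwards [nhdsWithin_le_nhds (hU.mem_nhds h0)] with x hx
    rw [complexMGF_ofReal, complexMGF_ofReal, h hx]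
  refine Measure.ext_of_charFun (funext fun t => ?_)
  rw [← complexMGF_id_mul_I, ← complexMGF_id_mul_I]
  exact key (by simpa using h0)

/-- Uniqueness of Laplace transforms that are finite on `(0, ∞)`. -/
theorem MeasureTheory.Measure.ext_of_laplace_eq {A B : Measure ℝ}
    (hfin : ∀ l : ℝ, 0 < l → ∫⁻ t, ENNReal.ofReal (Real.exp (-l * t)) ∂A ≠ ⊤)
    (h : ∀ l : ℝ, 0 < l → ∫⁻ t, ENNReal.ofReal (Real.exp (-l * t)) ∂A
      = ∫⁻ t, ENNReal.ofReal (Real.exp (-l * t)) ∂B) : A = B := by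
  let w : ℝ → ℝ≥0∞ := fun t => ENNReal.ofReal (Real.exp (-t))
  have hw : Measurable w := by fun_prop
  have hlin (C : Measure ℝ) (u : ℝ) :
      ∫⁻ t, ENNReal.ofReal (Real.exp (u * t)) ∂(C.withDensity w)
        = ∫⁻ t, ENNReal.ofReal (Real.exp (-(1 - u) * t)) ∂C := by
    rw [lintegral_withDensity_eq_lintegral_mul _ hw (by fun_prop)]
    refine lintegral_congr fun t => ?_
    simp only [Pi.mul_apply, w]
    rw [← ENNReal.ofReal_mul (by positivity), ← Real.exp_add]
    ring_nf
  have hfinite (C : Measure ℝ)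
      (hC : ∀ l : ℝ, 0 < l → ∫⁻ t, ENNReal.ofReal (Real.exp (-l * t)) ∂C ≠ ⊤) :
      IsFiniteMeasure (C.withDensity w) :=
    isFiniteMeasure_withDensity (by simpa [w] using hC 1 one_pos)
  have hset (C : Measure ℝ)
      (hC : ∀ l : ℝ, 0 < l → ∫⁻ t, ENNReal.ofReal (Real.exp (-l * t)) ∂C ≠ ⊤) :
      Iio (1 : ℝ) ⊆ ProbabilityTheory.integrableExpSet id (C.withDensity w) := by
    intro u hu
    refine (lintegral_ofReal_ne_top_iff_integrable (by fun_prop)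
      (Eventually.of_forall fun _ => by positivity)).1 ?_
    simpa [hlin] using hC (1 - u) (by simpa using hu)
  have hfinB : ∀ l : ℝ, 0 < l → ∫⁻ t, ENNReal.ofReal (Real.exp (-l * t)) ∂B ≠ ⊤ :=
    fun l hl => h l hl ▸ hfin l hl
  have := hfinite A hfin
  have := hfinite B hfinB
  have heq : A.withDensity w = B.withDensity w := by
    refine Measure.ext_of_mgf_eqOn isOpen_Iio (convex_Iio 1) (mem_Iio.2 one_pos)
      (hset A hfin) (hset B hfinB) fun u hu => ?_
    simp only [ProbabilityTheory.mgf, id]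
    rw [integral_eq_lintegral_of_nonneg_ae (Eventually.of_forall fun _ => by positivity)
      (by fun_prop), integral_eq_lintegral_of_nonneg_ae
      (Eventually.of_forall fun _ => by positivity) (by fun_prop), hlin, hlin,
      h (1 - u) (by simpa using hu)]
  have hinv (C : Measure ℝ) : (C.withDensity w).withDensity w⁻¹ = C :=
    withDensity_inv_same hw (Eventually.of_forall fun t => by simp [w, Real.exp_pos])
      (Eventually.of_forall fun t => by simp [w])
  rw [← hinv A, heq, hinv B]

/-- `x e^{-ax}` is dominated by a multiple of `min 1 x`. -/
theorem mul_exp_neg_le_min {a x : ℝ} (ha : 0 < a) (hx : 0 < x) :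
    x * Real.exp (-a * x) ≤ max 1 a⁻¹ * min 1 x := by
  have h1 : x * Real.exp (-a * x) ≤ x :=
    mul_le_of_le_one_right hx.le (Real.exp_le_one_iff.2 (by nlinarith))
  have h2 : x * Real.exp (-a * x) ≤ a⁻¹ := by
    rw [neg_mul, Real.exp_neg, ← div_eq_mul_inv, div_le_iff₀ (Real.exp_pos _),
      le_inv_mul_iff₀ ha]
    linarith [Real.add_one_le_exp (a * x)]
  rcases le_total 1 x with hx1 | hx1
  · rw [min_eq_left hx1, mul_one]
    exact h2.trans (le_max_right _ _)
  · rw [min_eq_right hx1]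
    exact h1.trans (le_mul_of_one_le_left hx.le (le_max_left _ _))

theorem one_sub_exp_neg_le_min {a x : ℝ} (hx : 0 < x) :
    1 - Real.exp (-a * x) ≤ max 1 a * min 1 x := by
  have h1 : 1 - Real.exp (-a * x) ≤ a * x := by linarith [Real.add_one_le_exp (-a * x)]
  have h2 : 1 - Real.exp (-a * x) ≤ 1 := by linarith [Real.exp_pos (-a * x)]
  rcases le_total 1 x with hx1 | hx1
  · rw [min_eq_left hx1, mul_one]
    exact h2.trans (le_max_left _ _)
  · rw [min_eq_right hx1]
    exact h1.trans (by gcongr; exact le_max_right _ _)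

section LaplaceExponent

variable {m : Measure ℝ}

theorem integrable_min_one (hpos : ∀ᵐ x ∂m, 0 < x)
    (hm : ∫⁻ x, ENNReal.ofReal (min 1 x) ∂m ≠ ⊤) : Integrable (fun x => min 1 x) m :=
  (lintegral_ofReal_ne_top_iff_integrable (by fun_prop)
    (hpos.mono fun _ hx => le_min zero_le_one hx.le)).1 hm

theorem integrable_one_sub_exp_neg (hpos : ∀ᵐ x ∂m, 0 < x)
    (hm : ∫⁻ x, ENNReal.ofReal (min 1 x) ∂m ≠ ⊤) {l : ℝ} (hl : 0 < l) :
    Integrable (fun x => 1 - Real.exp (-l * x)) m := by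
  refine ((integrable_min_one hpos hm).const_mul (max 1 l)).mono' (by fun_prop) ?_
  filter_upwards [hpos] with x hx
  rw [Real.norm_of_nonneg (sub_nonneg.2 (Real.exp_le_one_iff.2 (by nlinarith)))]
  exact one_sub_exp_neg_le_min hx

/-- Differentiation of a Laplace exponent under the integral sign. -/
theorem hasDerivAt_laplaceExponent (hpos : ∀ᵐ x ∂m, 0 < x)
    (hm : ∫⁻ x, ENNReal.ofReal (min 1 x) ∂m ≠ ⊤) {l : ℝ} (hl : 0 < l) :
    Integrable (fun x => x * Real.exp (-l * x)) m ∧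
      HasDerivAt (fun l => ∫ x, (1 - Real.exp (-l * x)) ∂m)
        (∫ x, x * Real.exp (-l * x) ∂m) l := by
  refine hasDerivAt_integral_of_dominated_loc_of_deriv_le (s := Ioi (l / 2))
    (bound := fun x => max 1 (l / 2)⁻¹ * min 1 x)
    (F := fun l x => 1 - Real.exp (-l * x)) (F' := fun l x => x * Real.exp (-l * x))
    (Ioi_mem_nhds (by linarith)) (Eventually.of_forall fun _ => by fun_prop)
    (integrable_one_sub_exp_neg hpos hm hl) (by fun_prop) ?_
    ((integrable_min_one hpos hm).const_mul _) ?_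
  · filter_upwards [hpos] with x hx y hy
    rw [Real.norm_of_nonneg (by positivity)]
    refine le_trans ?_ (mul_exp_neg_le_min (half_pos hl) hx)
    have : l / 2 < y := hy
    gcongr
  · refine Eventually.of_forall fun x y _ => ?_
    have := (((hasDerivAt_id y).neg.mul_const x).exp).const_sub 1
    simpa [mul_comm] using this

open ProbabilityTheory in
/-- The first exponentially weighted moment of a law with Laplace transform `exp (-r φ)`, where
`φ` is the Laplace exponent with Lévy measure `m`. -/
theorem lintegral_mul_exp_neg_of_laplace (hpos : ∀ᵐ x ∂m, 0 < x)
    (hm : ∫⁻ x, ENNReal.ofReal (min 1 x) ∂m ≠ ⊤) {P : Measure ℝ} [IsProbabilityMeasure P]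
    (hP : ∀ᵐ s ∂P, 0 ≤ s) {r : ℝ} (hr : 0 < r)
    (hlap : ∀ l : ℝ, 0 < l →
      ∫ s, Real.exp (-l * s) ∂P = Real.exp (-r * ∫ x, (1 - Real.exp (-l * x)) ∂m))
    {l : ℝ} (hl : 0 < l) :
    ∫⁻ s, ENNReal.ofReal s * ENNReal.ofReal (Real.exp (-l * s)) ∂P
        = ENNReal.ofReal r * (∫⁻ x, ENNReal.ofReal x * ENNReal.ofReal (Real.exp (-l * x)) ∂m)
          * ∫⁻ s, ENNReal.ofReal (Real.exp (-l * s)) ∂P ∧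
      ∫⁻ s, ENNReal.ofReal s * ENNReal.ofReal (Real.exp (-l * s)) ∂P ≠ ⊤ := by
  have hint (u : ℝ) (hu : u ≤ 0) : Integrable (fun s => Real.exp (u * s)) P := by
    refine (integrable_const (1 : ℝ)).mono' (by fun_prop) ?_
    filter_upwards [hP] with s hs
    rw [Real.norm_of_nonneg (by positivity)]
    exact Real.exp_le_one_iff.2 (mul_nonpos_of_nonpos_of_nonneg hu hs)
  have hmem : -l ∈ interior (integrableExpSet id P) :=
    interior_maximal (fun u hu => hint u (le_of_lt hu)) isOpen_Iio (mem_Iio.2 (neg_lt_zero.2 hl))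
  obtain ⟨hDint, hD⟩ := hasDerivAt_laplaceExponent hpos hm hl
  set D := ∫ x, x * Real.exp (-l * x) ∂m with hDdef
  have h1 : HasDerivAt (fun y => mgf id P (-y)) (-∫ s, s * Real.exp (-l * s) ∂P) l := by
    have := (hasDerivAt_mgf hmem).scomp l (hasDerivAt_neg l)
    simpa [Function.comp_def] using this
  have h2 : HasDerivAt (fun y => mgf id P (-y))
      (Real.exp (-r * ∫ x, (1 - Real.exp (-l * x)) ∂m) * (-r * D)) l := by
    refine ((hD.const_mul (-r)).exp).congr_of_eventuallyEq ?_
    filter_upwards [Ioi_mem_nhds hl] with y hy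
    simpa [mgf] using hlap y hy
  have h3 := h1.unique h2
  rw [← hlap l hl] at h3
  have hPint : Integrable (fun s => s * Real.exp (-l * s)) P := by
    simpa using integrable_pow_mul_exp_of_mem_interior_integrableExpSet hmem 1
  have e1 : ∫⁻ s, ENNReal.ofReal s * ENNReal.ofReal (Real.exp (-l * s)) ∂P
      = ENNReal.ofReal (∫ s, s * Real.exp (-l * s) ∂P) := by
    rw [ofReal_integral_eq_lintegral_ofReal hPint
      (hP.mono fun s hs => mul_nonneg hs (Real.exp_pos _).le)]
    exact lintegral_congr fun s => (ENNReal.ofReal_mul' (Real.exp_pos _).le).symm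
  have e2 : ∫⁻ x, ENNReal.ofReal x * ENNReal.ofReal (Real.exp (-l * x)) ∂m
      = ENNReal.ofReal D := by
    rw [hDdef, ofReal_integral_eq_lintegral_ofReal hDint
      (hpos.mono fun s hs => mul_nonneg hs.le (Real.exp_pos _).le)]
    exact lintegral_congr fun s => (ENNReal.ofReal_mul' (Real.exp_pos _).le).symm
  have e3 : ∫⁻ s, ENNReal.ofReal (Real.exp (-l * s)) ∂P
      = ENNReal.ofReal (∫ s, Real.exp (-l * s) ∂P) :=
    (ofReal_integral_eq_lintegral_ofReal (hint _ (by linarith))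
      (Eventually.of_forall fun _ => by positivity)).symm
  refine ⟨?_, e1 ▸ ENNReal.ofReal_ne_top⟩
  rw [e1, e2, e3, ← ENNReal.ofReal_mul hr.le,
    ← ENNReal.ofReal_mul' (integral_nonneg fun _ => by positivity)]
  congr 1
  linarith

end LaplaceExponent

section Density

variable {q : ℝ → ℝ}

/-- Multiplying by `t`, a law with a Laplace transform `exp (-r φ)` becomes `r` times its
convolution with the measure `x m(dx)`; this is the resulting identity between densities. -/
theorem ae_mul_density_eq_lconvolution (hq : Measurable q)
    (hm : ∫⁻ x, ENNReal.ofReal (min 1 x)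
      ∂((volume.restrict (Ioi 0)).withDensity fun x => ENNReal.ofReal (q x)) ≠ ⊤)
    {p : ℝ → ℝ} (hp : Continuous p) {P : Measure ℝ} [IsProbabilityMeasure P]
    (hP : P = (volume.restrict (Ici 0)).withDensity fun x => ENNReal.ofReal (p x))
    {r : ℝ} (hr : 0 < r)
    (hlap : ∀ l : ℝ, 0 < l →
      ∫ s, Real.exp (-l * s) ∂P = Real.exp (-r * ∫ x, (1 - Real.exp (-l * x))
        ∂((volume.restrict (Ioi 0)).withDensity fun x => ENNReal.ofReal (q x)))) :
    ∀ᵐ t : ℝ, 0 < t → ENNReal.ofReal (t * p t) = ENNReal.ofReal r *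
      ∫⁻ s in Ioi 0, ENNReal.ofReal (s * q s) *
        (Ici 0).indicator (fun x => ENNReal.ofReal (p x)) (t - s) := by
  set m := (volume.restrict (Ioi (0 : ℝ))).withDensity fun x => ENNReal.ofReal (q x) with hmdef
  have hqm : Measurable fun x => ENNReal.ofReal (q x) := by fun_prop
  have hid : Measurable fun x : ℝ => ENNReal.ofReal x := by fun_prop
  have hpos : ∀ᵐ x ∂m, 0 < x :=
    (withDensity_absolutelyContinuous _ _).ae_le (ae_restrict_mem measurableSet_Ioi)
  have hPnn : ∀ᵐ x ∂P, 0 ≤ x := by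
    rw [hP]
    exact (withDensity_absolutelyContinuous _ _).ae_le (ae_restrict_mem measurableSet_Ici)
  let f : ℝ → ℝ≥0∞ := (Ici 0).indicator fun x => ENNReal.ofReal (p x)
  let g : ℝ → ℝ≥0∞ := (Ioi 0).indicator fun x => ENNReal.ofReal (q x) * ENNReal.ofReal x
  have hf : Measurable f :=
    (ENNReal.measurable_ofReal.comp hp.measurable).indicator measurableSet_Ici
  have hg : Measurable g := (by fun_prop : Measurable fun x : ℝ =>
    ENNReal.ofReal (q x) * ENNReal.ofReal x).indicator measurableSet_Ioi
  have hPf : P = volume.withDensity f := by rw [hP, withDensity_indicator measurableSet_Ici]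
  have hmg : m.withDensity (fun x => ENNReal.ofReal x) = volume.withDensity g := by
    rw [hmdef, ← withDensity_mul _ hqm hid, withDensity_indicator measurableSet_Ioi]
    rfl
  have hA (l : ℝ) : ∫⁻ t, ENNReal.ofReal (Real.exp (-l * t))
        ∂(volume.withDensity (f * fun x => ENNReal.ofReal x))
      = ∫⁻ s, ENNReal.ofReal s * ENNReal.ofReal (Real.exp (-l * s)) ∂P := by
    rw [withDensity_mul _ hf hid, ← hPf,
      lintegral_withDensity_eq_lintegral_mul _ hid (by fun_prop)]
    rfl
  have hB (l : ℝ) : ∫⁻ t, ENNReal.ofReal (Real.exp (-l * t))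
        ∂(volume.withDensity (ENNReal.ofReal r • (g ⋆ₗ f)))
      = ENNReal.ofReal r * (∫⁻ x, ENNReal.ofReal x * ENNReal.ofReal (Real.exp (-l * x)) ∂m)
          * ∫⁻ s, ENNReal.ofReal (Real.exp (-l * s)) ∂P := by
    rw [withDensity_smul _ (measurable_lconvolution _ hg hf),
      ← conv_withDensity_eq_lconvolution hg hf, ← hPf, ← hmg, lintegral_smul_measure,
      Measure.lintegral_conv (by fun_prop), smul_eq_mul, mul_assoc]
    congr 1
    have e (x y : ℝ) : ENNReal.ofReal (Real.exp (-l * (x + y)))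
        = ENNReal.ofReal (Real.exp (-l * x)) * ENNReal.ofReal (Real.exp (-l * y)) := by
      rw [← ENNReal.ofReal_mul (by positivity), ← Real.exp_add, mul_add]
    simp_rw [e]
    simp_rw [lintegral_const_mul _ (by fun_prop : Measurable fun y : ℝ =>
      ENNReal.ofReal (Real.exp (-l * y)))]
    rw [lintegral_mul_const _ (by fun_prop),
      lintegral_withDensity_eq_lintegral_mul _ hid (by fun_prop)]
    rfl
  have key : volume.withDensity (f * fun x => ENNReal.ofReal x)
      = volume.withDensity (ENNReal.ofReal r • (g ⋆ₗ f)) := by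
    refine Measure.ext_of_laplace_eq (fun l hl => ?_) fun l hl => ?_
    · rw [hA]
      exact (lintegral_mul_exp_neg_of_laplace hpos hm hPnn hr hlap hl).2
    · rw [hA, hB]
      exact (lintegral_mul_exp_neg_of_laplace hpos hm hPnn hr hlap hl).1
  rw [withDensity_eq_iff_of_sigmaFinite (hf.mul hid).aemeasurable
    ((measurable_lconvolution _ hg hf).const_smul _).aemeasurable] at key
  filter_upwards [key] with t ht h0
  simp only [Pi.mul_apply, Pi.smul_apply, lconvolution_def, smul_eq_mul, f, g] at ht
  rw [indicator_of_mem (mem_Ici.2 h0.le), mul_comm, ← ENNReal.ofReal_mul h0.le] at ht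
  rw [ht, ← lintegral_indicator measurableSet_Ioi]
  congr 1
  refine lintegral_congr fun s => ?_
  by_cases hs : s ∈ Ioi (0 : ℝ)
  · rw [indicator_of_mem hs, indicator_of_mem hs, ENNReal.ofReal_mul (le_of_lt hs),
      mul_comm (ENNReal.ofReal (q s)), neg_add_eq_sub]
  · rw [indicator_of_notMem hs, indicator_of_notMem hs, zero_mul]

theorem intervalIntegrable_mul_density (hq : Measurable q)
    (hqnn : ∀ t, 0 ≤ q t)
    (hm : ∫⁻ x, ENNReal.ofReal (min 1 x)
      ∂((volume.restrict (Ioi 0)).withDensity fun x => ENNReal.ofReal (q x)) ≠ ⊤)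
    {T : ℝ} (hT : 0 ≤ T) : IntervalIntegrable (fun x => x * q x) volume 0 T := by
  rw [lintegral_withDensity_eq_lintegral_mul _ (by fun_prop) (by fun_prop)] at hm
  have hint : Integrable (fun x => q x * min 1 x) (volume.restrict (Ioi 0)) := by
    refine (lintegral_ofReal_ne_top_iff_integrable (by fun_prop) ?_).1 ?_
    · filter_upwards [ae_restrict_mem measurableSet_Ioi] with x hx
      exact mul_nonneg (hqnn x) (le_min zero_le_one (le_of_lt hx))
    · simpa only [Pi.mul_apply, ENNReal.ofReal_mul (hqnn _)] using hm
  rw [intervalIntegrable_iff_integrableOn_Ioc_of_le hT]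
  refine ((IntegrableOn.mono_set hint Ioc_subset_Ioi_self).const_mul (max 1 T)).mono'
    (by fun_prop) ?_
  filter_upwards [ae_restrict_mem measurableSet_Ioc] with x hx
  rw [Real.norm_of_nonneg (mul_nonneg hx.1.le (hqnn x))]
  have : x ≤ max 1 T * min 1 x := by
    rcases le_total 1 x with h | h
    · rw [min_eq_left h, mul_one]
      exact hx.2.trans (le_max_right _ _)
    · rw [min_eq_right h]
      exact le_mul_of_one_le_left hx.1.le (le_max_left _ _)
  nlinarith [hqnn x]

/-- Lower bound of a Laplace exponent by the truncated first moment of its Lévy measure. -/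
theorem integral_mul_density_le_laplaceExponent (hq : Measurable q)
    (hqnn : ∀ t, 0 ≤ q t)
    (hm : ∫⁻ x, ENNReal.ofReal (min 1 x)
      ∂((volume.restrict (Ioi 0)).withDensity fun x => ENNReal.ofReal (q x)) ≠ ⊤)
    {δ : ℝ} (hδ : 0 < δ) :
    (∫ x in 0..δ, x * q x) / (2 * δ) ≤ ∫ x, (1 - Real.exp (-δ⁻¹ * x))
      ∂((volume.restrict (Ioi 0)).withDensity fun x => ENNReal.ofReal (q x)) := by
  have hpos : ∀ᵐ x ∂((volume.restrict (Ioi 0)).withDensity fun x => ENNReal.ofReal (q x)),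
      0 < x :=
    (withDensity_absolutelyContinuous _ _).ae_le (ae_restrict_mem measurableSet_Ioi)
  have hI := integrable_one_sub_exp_neg hpos hm (inv_pos.2 hδ)
  rw [integral_withDensity_eq_integral_toReal_smul (by fun_prop) (by simp),
    intervalIntegral.integral_of_le hδ.le, ← integral_div]
  rw [integrable_withDensity_iff_integrable_smul' (by fun_prop) (by simp)] at hI
  refine le_trans ?_ (setIntegral_mono_set hI ?_ ((Ioc_subset_Ioi_self (b := (0 : ℝ)) (a := δ)).eventuallyLE))
  · refine setIntegral_mono_on ?_ (IntegrableOn.mono_set hI Ioc_subset_Ioi_self)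
      measurableSet_Ioc fun x hx => ?_
    · exact ((intervalIntegrable_iff_integrableOn_Ioc_of_le hδ.le).1
        (intervalIntegrable_mul_density hq hqnn hm hδ.le)).div_const _
    · rw [ENNReal.toReal_ofReal (hqnn x), smul_eq_mul]
      have hy1 : δ⁻¹ * x ≤ 1 := by rw [inv_mul_le_iff₀ hδ]; linarith [hx.2]
      have hy0 : 0 ≤ δ⁻¹ * x := mul_nonneg (inv_pos.2 hδ).le hx.1.le
      have e : x * q x / (2 * δ) = q x * (δ⁻¹ * x / 2) := by field_simp
      rw [e]
      refine mul_le_mul_of_nonneg_left ?_ (hqnn x)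
      set y := δ⁻¹ * x
      have h1 : Real.exp (-δ⁻¹ * x) ≤ 1 - y / 2 := by
        rw [neg_mul, Real.exp_neg, inv_le_comm₀ (Real.exp_pos _) (by linarith)]
        refine le_trans ?_ (Real.add_one_le_exp y)
        rw [inv_le_iff_one_le_mul₀ (by linarith)]
        nlinarith
      linarith
  · filter_upwards [ae_restrict_mem measurableSet_Ioi] with x hx
    have : Real.exp (-δ⁻¹ * x) ≤ 1 := Real.exp_le_one_iff.2
      (mul_nonpos_of_nonpos_of_nonneg (neg_nonpos.2 (inv_pos.2 hδ).le) (le_of_lt hx))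
    exact mul_nonneg ENNReal.toReal_nonneg (sub_nonneg.2 this)


/-- Splitting the convolution identity of `ae_mul_density_eq_lconvolution` at `δ`. -/
theorem mul_density_le_of_lconvolution (hqnn : ∀ t, 0 ≤ q t)
    (hanti : AntitoneOn (fun t => t * q t) (Ioi 0))
    {p : ℝ → ℝ} {P : Measure ℝ} [IsProbabilityMeasure P]
    (hP : P = (volume.restrict (Ici 0)).withDensity fun x => ENNReal.ofReal (p x))
    {r s δ M : ℝ} (hr : 0 < r) (hδ : 0 < δ)
    (hint : IntervalIntegrable (fun x => x * q x) volume 0 δ)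
    (hM : ∀ x ∈ Icc 0 s, p x ≤ M) (hM0 : 0 ≤ M)
    (hs : ENNReal.ofReal (s * p s) = ENNReal.ofReal r *
      ∫⁻ y in Ioi 0, ENNReal.ofReal (y * q y) *
        (Ici 0).indicator (fun x => ENNReal.ofReal (p x)) (s - y)) :
    s * p s ≤ r * (M * (∫ x in 0..δ, x * q x) + δ * q δ * P.real (Iio (s - δ))) := by
  let f : ℝ → ℝ≥0∞ := (Ici 0).indicator fun x => ENNReal.ofReal (p x)
  have hPf : P = volume.withDensity f := by rw [hP, withDensity_indicator measurableSet_Ici]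
  have hG0 : 0 ≤ ∫ x in 0..δ, x * q x :=
    intervalIntegral.integral_nonneg hδ.le fun x hx => mul_nonneg hx.1 (hqnn x)
  have hkδ : 0 ≤ δ * q δ := mul_nonneg hδ.le (hqnn δ)
  have h1 : ∫⁻ y in Ioc 0 δ, ENNReal.ofReal (y * q y) * f (s - y)
      ≤ ENNReal.ofReal (M * ∫ x in 0..δ, x * q x) := by
    rw [mul_comm M, ENNReal.ofReal_mul hG0, intervalIntegral.integral_of_le hδ.le,
      ofReal_integral_eq_lintegral_ofReal
        ((intervalIntegrable_iff_integrableOn_Ioc_of_le hδ.le).1 hint)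
        ((ae_restrict_mem measurableSet_Ioc).mono fun x hx => mul_nonneg hx.1.le (hqnn x)),
      ← lintegral_mul_const' _ _ ENNReal.ofReal_ne_top]
    refine setLIntegral_mono' measurableSet_Ioc fun y hy => ?_
    gcongr
    by_cases h0 : 0 ≤ s - y
    · simp only [f]
      rw [indicator_of_mem (mem_Ici.2 h0)]
      exact ENNReal.ofReal_le_ofReal (hM _ ⟨h0, by linarith [hy.1]⟩)
    · simp only [f]
      rw [indicator_of_notMem (by simpa using h0)]
      exact zero_le
  have h2 : ∫⁻ y in Ioi δ, ENNReal.ofReal (y * q y) * f (s - y)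
      ≤ ENNReal.ofReal (δ * q δ * P.real (Iio (s - δ))) := by
    rw [ENNReal.ofReal_mul hkδ, ofReal_measureReal]
    calc ∫⁻ y in Ioi δ, ENNReal.ofReal (y * q y) * f (s - y)
        ≤ ∫⁻ y in Ioi δ, ENNReal.ofReal (δ * q δ) * f (s - y) := by
          refine setLIntegral_mono' measurableSet_Ioi fun y hy => ?_
          gcongr ENNReal.ofReal ?_ * _
          exact hanti hδ (hδ.trans hy) (le_of_lt hy)
      _ = ENNReal.ofReal (δ * q δ) * ∫⁻ y in Ioi δ, f (s - y) :=
          lintegral_const_mul' _ _ ENNReal.ofReal_ne_top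
      _ = ENNReal.ofReal (δ * q δ) * P (Iio (s - δ)) := by
          rw [hPf, withDensity_apply _ measurableSet_Iio, ← lintegral_indicator measurableSet_Iio,
            ← lintegral_indicator measurableSet_Ioi,
            ← lintegral_sub_left_eq_self ((Iio (s - δ)).indicator f) s]
          congr 1
          refine lintegral_congr fun y => ?_
          simp only [indicator, mem_Ioi, mem_Iio, sub_lt_sub_iff_left]
  have h3 : ∫⁻ y in Ioi 0, ENNReal.ofReal (y * q y) * f (s - y)
      ≤ ENNReal.ofReal (M * (∫ x in 0..δ, x * q x) + δ * q δ * P.real (Iio (s - δ))) := by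
    rw [← Ioc_union_Ioi_eq_Ioi hδ.le, lintegral_union measurableSet_Ioi
      (Ioc_disjoint_Ioi le_rfl), ENNReal.ofReal_add (mul_nonneg hM0 hG0)
      (mul_nonneg hkδ measureReal_nonneg)]
    exact add_le_add h1 h2
  have hR : 0 ≤ M * (∫ x in 0..δ, x * q x) + δ * q δ * P.real (Iio (s - δ)) :=
    add_nonneg (mul_nonneg hM0 hG0) (mul_nonneg hkδ measureReal_nonneg)
  rw [← ENNReal.ofReal_le_ofReal_iff (mul_nonneg hr.le hR), hs, ENNReal.ofReal_mul hr.le]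
  gcongr

/-- A positive value `p t` of the density is bounded by `P (Iio s) / δ`, where `s ≤ t` and the
truncated first moment of the Lévy measure up to `δ` equals `s / (4 r)`. -/
theorem density_le_of_lconvolution (hqnn : ∀ t, 0 ≤ q t)
    (hanti : AntitoneOn (fun t => t * q t) (Ioi 0))
    (hint : ∀ T : ℝ, 0 ≤ T → IntervalIntegrable (fun x => x * q x) volume 0 T)
    {p : ℝ → ℝ} (hp : Continuous p) {P : Measure ℝ} [IsProbabilityMeasure P]
    (hP : P = (volume.restrict (Ici 0)).withDensity fun x => ENNReal.ofReal (p x))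
    {r : ℝ} (hr : 0 < r)
    (hconv : ∀ᵐ t : ℝ, 0 < t → ENNReal.ofReal (t * p t) = ENNReal.ofReal r *
      ∫⁻ s in Ioi 0, ENNReal.ofReal (s * q s) *
        (Ici 0).indicator (fun x => ENNReal.ofReal (p x)) (t - s))
    {t : ℝ} (ht : 0 < t) (hpt : 0 < p t) :
    ∃ s δ : ℝ, 0 < s ∧ 0 < δ ∧ r * (∫ x in 0..δ, x * q x) = s / 4 ∧
      p t ≤ P.real (Iio s) / δ := by
  obtain ⟨x₀, hx₀, hmax⟩ := isCompact_Icc.exists_isMaxOn (nonempty_Icc.2 ht.le)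
    (hp.continuousOn (s := Icc 0 t))
  set M := p x₀
  have htM : p t ≤ M := hmax (right_mem_Icc.2 ht.le)
  have hM : 0 < M := hpt.trans_le htM
  obtain ⟨s, ⟨hsM, hs0, hst⟩, hs⟩ : ∃ s, s ∈ {x | M / 2 < p x} ∩ Ioo 0 t ∧ (0 < s →
      ENNReal.ofReal (s * p s) = ENNReal.ofReal r *
      ∫⁻ y in Ioi 0, ENNReal.ofReal (y * q y) *
        (Ici 0).indicator (fun x => ENNReal.ofReal (p x)) (s - y)) := by
    have hopen : IsOpen {x | M / 2 < p x} := isOpen_lt continuous_const hp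
    have hne : ({x | M / 2 < p x} ∩ Ioo 0 t).Nonempty := by
      rw [← closure_Ioo ht.ne] at hx₀
      exact mem_closure_iff.1 hx₀ _ hopen (half_lt_self hM)
    obtain ⟨s, h1, h2⟩ :=
      (Measure.dense_of_ae hconv).inter_open_nonempty _ (hopen.inter isOpen_Ioo) hne
    exact ⟨s, h1, h2⟩
  have hbound (δ : ℝ) (hδ : 0 < δ) := mul_density_le_of_lconvolution hqnn hanti hP hr hδ
    (hint δ hδ.le) (fun x hx => hmax ⟨hx.1, hx.2.trans hst.le⟩) hM.le (hs hs0)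
  have hsM' : M / 2 < p s := hsM
  have hlow : s * (M / 2) < s * p s := by gcongr
  have hG : s / (4 * r) ≤ ∫ x in 0..s, x * q x := by
    have hz : P.real (Iio (s - s)) = 0 := by
      rw [sub_self, measureReal_def, hP, withDensity_apply _ measurableSet_Iio,
        Measure.restrict_restrict measurableSet_Iio, Iio_inter_Ici, Ico_self]
      simp
    have := hbound s hs0
    rw [hz, mul_zero, add_zero] at this
    rw [div_le_iff₀ (by positivity)]
    refine le_of_mul_le_mul_right ?_ hM
    nlinarith
  have hcont : ContinuousOn (fun δ => ∫ x in 0..δ, x * q x) (Icc 0 s) := by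
    have := intervalIntegral.continuousOn_primitive_interval
      (a := 0) (b := s) (μ := volume) (f := fun x => x * q x)
      (by rw [uIcc_of_le hs0.le, integrableOn_Icc_iff_integrableOn_Ioc]
          exact (intervalIntegrable_iff_integrableOn_Ioc_of_le hs0.le).1 (hint s hs0.le))
    rwa [uIcc_of_le hs0.le] at this
  obtain ⟨δ, ⟨hδ0, hδs⟩, hδ⟩ := intermediate_value_Icc hs0.le hcont
    (⟨by rw [intervalIntegral.integral_same]; positivity, hG⟩ :
      s / (4 * r) ∈ Icc (∫ x in (0 : ℝ)..0, x * q x) (∫ x in 0..s, x * q x))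
  replace hδ : ∫ x in 0..δ, x * q x = s / (4 * r) := hδ
  have hδpos : 0 < δ := by
    refine hδ0.lt_of_ne fun h => ?_
    rw [← h, intervalIntegral.integral_same] at hδ
    exact (by positivity : s / (4 * r) ≠ 0) hδ.symm
  refine ⟨s, δ, hs0, hδpos, by rw [hδ]; field_simp, htM.trans ?_⟩
  have hk : δ * (δ * q δ) ≤ s / (4 * r) := by
    rw [← hδ]
    have := intervalIntegral.integral_mono_on_of_le_Ioo hδ0
      (intervalIntegrable_const (c := δ * q δ)) (hint δ hδ0)
      fun x hx => hanti hx.1 hδpos hx.2.le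
    simpa using this
  have hF : P.real (Iio (s - δ)) ≤ P.real (Iio s) :=
    measureReal_mono (Iio_subset_Iio (by linarith))
  have hb := hbound δ hδpos
  rw [hδ] at hb
  have hF0 : 0 ≤ P.real (Iio (s - δ)) := measureReal_nonneg
  set F := P.real (Iio s)
  have h5 : s * (M / 2) ≤ r * (M * (s / (4 * r))) + r * (δ * q δ * F) := by
    refine hlow.le.trans (hb.trans ?_)
    rw [mul_add]
    have := mul_nonneg hδ0 (hqnn δ)
    gcongr
  have h6 : r * (M * (s / (4 * r))) = M * s / 4 := by field_simp
  have h7 : s * M / 4 * δ ≤ s / 4 * F := by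
    have e1 : δ * (r * (δ * q δ * F)) = r * F * (δ * (δ * q δ)) := by ring
    have e2 : r * F * (δ * (δ * q δ)) ≤ r * F * (s / (4 * r)) := by
      have : 0 ≤ F := measureReal_nonneg
      gcongr
    have e3 : r * F * (s / (4 * r)) = s / 4 * F := by field_simp
    nlinarith
  rw [le_div_iff₀ hδpos]
  nlinarith

end Density

/-- A stretched exponential beats the identity function. -/
theorem exists_mul_exp_neg_rpow_le {b c : ℝ} (hb : 0 < b) (hc : 0 < c) :
    ∃ C : ℝ, ∀ u : ℝ, 1 ≤ u → u * Real.exp (-(c * u ^ b)) ≤ C := by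
  obtain ⟨n, hn⟩ := exists_nat_ge b⁻¹
  refine ⟨n.factorial / c ^ n, fun u hu => ?_⟩
  have hu0 : 0 < u := one_pos.trans_le hu
  have h1 : u ≤ (u ^ b) ^ n := by
    rw [← Real.rpow_natCast, ← Real.rpow_mul hu0.le]
    refine Real.self_le_rpow_of_one_le hu ?_
    rwa [← inv_le_iff_one_le_mul₀' hb]
  have h2 := Real.pow_div_factorial_le_exp _ (mul_nonneg hc.le (Real.rpow_nonneg hu0.le b)) n
  rw [Real.exp_neg, ← div_eq_mul_inv, div_le_div_iff₀ (Real.exp_pos _) (by positivity)]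
  rw [div_le_iff₀' (by positivity), mul_pow] at h2
  calc u * c ^ n ≤ (u ^ b) ^ n * c ^ n := by gcongr
    _ ≤ _ := by linarith

/-- Chernoff bound for the lower tail of a law on `[0, ∞)`. -/
theorem measureReal_Iio_le_exp_mul_laplace {P : Measure ℝ} [IsProbabilityMeasure P]
    (hP : ∀ᵐ s ∂P, 0 ≤ s) {l : ℝ} (hl : 0 ≤ l) (s : ℝ) :
    P.real (Iio s) ≤ Real.exp (l * s) * ∫ x, Real.exp (-l * x) ∂P := by
  have hint : Integrable (fun x => Real.exp (-l * x)) P := by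
    refine (integrable_const (1 : ℝ)).mono' (by fun_prop) ?_
    filter_upwards [hP] with x hx
    rw [Real.norm_of_nonneg (by positivity)]
    exact Real.exp_le_one_iff.2 (mul_nonpos_of_nonpos_of_nonneg (neg_nonpos.2 hl) hx)
  have := ProbabilityTheory.measure_le_le_exp_mul_mgf (X := id) s (neg_nonpos.2 hl) hint
  rw [neg_neg] at this
  exact (measureReal_mono fun x (hx : x < s) => hx.le).trans this

/-- Lemma 4.5(ii).  Under Assumption 4.1, there is a constant `c > 0`
such that `p̄(r,t) ≤ c φ⁻¹(1/r)` for all `r, t > 0`. -/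
theorem time_frac_stmt13
    (ν : Measure ℝ)
    (hν_loc : ∫⁻ x in Set.Ioi (0:ℝ), ENNReal.ofReal (min 1 x) ∂ν ≠ ⊤)
    (φ : ℝ → ℝ)
    (hφ : ∀ l : ℝ, 0 < l → φ l = ∫ x in Set.Ioi (0:ℝ), (1 - Real.exp (-l * x)) ∂ν)
    -- Assumption 4.1(i): weak scaling of φ
    (β₁ β₂ c₁ c₂ : ℝ)
    (hβ : 0 < β₁ ∧ β₁ < β₂ ∧ β₂ < 1) (hc : 0 < c₁ ∧ 0 < c₂)
    (hscale : ∀ l : ℝ, 0 < l → ∀ κ : ℝ, 1 ≤ κ →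
      c₁ * κ ^ β₁ ≤ φ (κ * l) / φ l ∧ φ (κ * l) / φ l ≤ c₂ * κ ^ β₂)
    -- Assumption 4.1(ii): ν has a density νd with t ↦ t·νd(t) non-increasing
    (νd : ℝ → ℝ)
    (hνd_nn : ∀ t : ℝ, 0 ≤ νd t)
    (hνd_meas : Measurable νd)
    (hν_dens : ∀ A : Set ℝ, MeasurableSet A →
      ν A = ∫⁻ x in A ∩ Set.Ioi 0, ENNReal.ofReal (νd x))
    (hself : AntitoneOn (fun t => t * νd t) (Set.Ioi (0:ℝ)))
    -- the inverse of φ on (0,∞)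
    (φinv : ℝ → ℝ)
    (hφinv : ∀ l : ℝ, 0 < l → 0 < φinv l ∧ φ (φinv l) = l)
    -- the subordinator marginals and their continuous densities
    (μr : ℝ → Measure ℝ)
    (hprob : ∀ r : ℝ, 0 < r → IsProbabilityMeasure (μr r))
    (hlap : ∀ r : ℝ, 0 < r → ∀ l : ℝ, 0 < l →
      ∫ s, Real.exp (-l * s) ∂(μr r) = Real.exp (-r * φ l))
    (pbar : ℝ → ℝ → ℝ)
    (hpbar_nn : ∀ r t : ℝ, 0 ≤ pbar r t)
    (hpbar_cont : ∀ r : ℝ, 0 < r → Continuous (pbar r))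
    (hdens : ∀ r : ℝ, 0 < r → ∀ A : Set ℝ, MeasurableSet A →
      μr r A = ∫⁻ t in A ∩ Set.Ici 0, ENNReal.ofReal (pbar r t)) :
    ∃ c : ℝ, 0 < c ∧ ∀ r t : ℝ, 0 < r → 0 < t → pbar r t ≤ c * φinv r⁻¹ := by
  obtain ⟨hβ₁, -, hβ₂⟩ := hβ
  obtain ⟨hc₁, hc₂⟩ := hc
  have hνeq : ν = (volume.restrict (Ioi 0)).withDensity fun x => ENNReal.ofReal (νd x) := by
    ext A hA
    rw [withDensity_apply _ hA, Measure.restrict_restrict hA, hν_dens A hA]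
  have hνr : ν.restrict (Ioi 0) = ν := by
    refine Measure.restrict_eq_self_of_ae_mem ?_
    rw [hνeq]
    exact (withDensity_absolutelyContinuous _ _).ae_le (ae_restrict_mem measurableSet_Ioi)
  simp only [hνr] at hν_loc hφ
  rw [hνeq] at hν_loc
  have hφ0 : ∀ l, 0 < l → 0 ≤ φ l := fun l hl => by
    rw [hφ l hl, hνeq]
    refine integral_nonneg_of_ae ((withDensity_absolutelyContinuous _ _).ae_le ?_)
    filter_upwards [ae_restrict_mem measurableSet_Ioi] with x hx
    exact sub_nonneg.2 (Real.exp_le_one_iff.2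
      (mul_nonpos_of_nonpos_of_nonneg (neg_nonpos.2 hl.le) (le_of_lt hx)))
  have hφpos : ∀ l, 0 < l → 0 < φ l := fun l hl => by
    refine (hφ0 l hl).lt_of_ne fun h => ?_
    have := (hscale l hl 1 le_rfl).1
    rw [← h, div_zero, Real.one_rpow, mul_one] at this
    exact this.not_gt hc₁
  rw [hνeq] at hφ
  obtain ⟨C, hC⟩ := exists_mul_exp_neg_rpow_le hβ₁ (half_pos hc₁)
  set κ : ℝ := max 1 ((16 * c₂) ^ (1 - β₂)⁻¹) with hκdef
  have hκ1 : 1 ≤ κ := le_max_left _ _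
  have hκ0 : 0 < κ := one_pos.trans_le hκ1
  have hκ : 16 * c₂ ≤ κ ^ (1 - β₂) := by
    have h : ((16 * c₂) ^ (1 - β₂)⁻¹) ^ (1 - β₂) ≤ κ ^ (1 - β₂) :=
      Real.rpow_le_rpow (by positivity) (le_max_right _ _) (by linarith)
    rwa [Real.rpow_inv_rpow (by positivity) (by linarith)] at h
  refine ⟨κ * max 1 C, by positivity, fun r t hr ht => ?_⟩
  have ha := (hφinv r⁻¹ (inv_pos.2 hr)).1
  have hφa := (hφinv r⁻¹ (inv_pos.2 hr)).2
  set a := φinv r⁻¹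
  rcases (hpbar_nn r t).eq_or_lt with h0 | hpt
  · rw [← h0]
    positivity
  have := hprob r hr
  have hμ : μr r = (volume.restrict (Ici 0)).withDensity fun x => ENNReal.ofReal (pbar r x) := by
    ext A hA
    rw [withDensity_apply _ hA, Measure.restrict_restrict hA, hdens r hr A hA]
  have hμnn : ∀ᵐ x ∂(μr r), 0 ≤ x := by
    rw [hμ]
    exact (withDensity_absolutelyContinuous _ _).ae_le (ae_restrict_mem measurableSet_Ici)
  have hconv := ae_mul_density_eq_lconvolution hνd_meas hν_loc (hpbar_cont r hr) hμ hr
    fun l hl => by rw [hlap r hr l hl, hφ l hl]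
  obtain ⟨s, δ, hs, hδ, hG, hle⟩ := density_le_of_lconvolution hνd_nn hself
    (fun T hT => intervalIntegrable_mul_density hνd_meas hνd_nn hν_loc hT)
    (hpbar_cont r hr) hμ hr hconv ht hpt
  have hφδ := integral_mul_density_le_laplaceExponent hνd_meas hνd_nn hν_loc hδ
  rw [← hφ _ (inv_pos.2 hδ)] at hφδ
  set l := δ⁻¹ / κ
  have hl : 0 < l := by positivity
  have hκl : κ * l = δ⁻¹ := mul_div_cancel₀ _ hκ0.ne'
  have hrφ : 2 * (l * s) ≤ r * φ l := by
    have h1 := (hscale l hl κ hκ1).2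
    rw [hκl, div_le_iff₀ (hφpos l hl)] at h1
    have h2 : s / (8 * δ) ≤ r * (c₂ * κ ^ β₂ * φ l) :=
      calc s / (8 * δ) = r * ((∫ x in 0..δ, x * νd x) / (2 * δ)) := by
            rw [mul_div_assoc', hG]
            field_simp
            norm_num
        _ ≤ _ := by gcongr; exact hφδ.trans h1
    have h3 : κ ^ (1 - β₂) * κ ^ β₂ = κ := by
      rw [← Real.rpow_add hκ0, sub_add_cancel, Real.rpow_one]
    have h4 : s / (8 * δ) = s * l * (κ ^ (1 - β₂) * κ ^ β₂) / 8 := by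
      rw [h3, mul_assoc, mul_comm l, hκl]
      field_simp
    have hκβ : 0 < κ ^ β₂ := Real.rpow_pos_of_pos hκ0 _
    have h5 : s * l * (16 * c₂ * κ ^ β₂) / 8 ≤ s * l * (κ ^ (1 - β₂) * κ ^ β₂) / 8 := by gcongr
    refine le_of_mul_le_mul_right ?_ (mul_pos hc₂ hκβ)
    linarith
  have hF : (μr r).real (Iio s) ≤ Real.exp (-(r * φ l / 2)) := by
    refine (measureReal_Iio_le_exp_mul_laplace hμnn hl.le s).trans ?_
    rw [hlap r hr l hl, ← Real.exp_add]
    exact Real.exp_le_exp.2 (by linarith)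
  have hmain : pbar r t ≤ κ * (l * Real.exp (-(r * φ l / 2))) := by
    refine hle.trans ?_
    rw [← mul_assoc, hκl, div_eq_inv_mul]
    gcongr
  refine hmain.trans ?_
  rw [mul_assoc]
  refine mul_le_mul_of_nonneg_left ?_ hκ0.le
  rcases le_total l a with hla | hla
  · calc l * Real.exp (-(r * φ l / 2)) ≤ a * 1 := by
          gcongr
          have := mul_pos hr (hφpos l hl)
          exact Real.exp_le_one_iff.2 (by linarith)
      _ ≤ max 1 C * a := by
          rw [mul_comm]
          gcongr
          exact le_max_left _ _
  · have hu : 1 ≤ l / a := (one_le_div ha).2 hla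
    have h1 := (hscale a ha (l / a) hu).1
    rw [div_mul_cancel₀ _ ha.ne', hφa, div_inv_eq_mul, mul_comm (φ l)] at h1
    calc l * Real.exp (-(r * φ l / 2))
        ≤ l * Real.exp (-(c₁ / 2 * (l / a) ^ β₁)) := by
          gcongr
          linarith
      _ = (l / a * Real.exp (-(c₁ / 2 * (l / a) ^ β₁))) * a := by field_simp
      _ ≤ max 1 C * a := by
          gcongr
          exact (hC _ hu).trans (le_max_right _ _)
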